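/- arXiv:1004.5123 — 2 statements merged into one kernel-verified Lean document; each statement's English description precedes it below -/
import Mathlib

section
/- Let Λ be a lattice of full rank in ℝ^d and let 0 < ε ≤ 1. Set H = {v ∈ Λ : ‖v‖_∞ < 1}. Then exp(−d·ε)·#H ≤ Σ_{v∈Λ} exp(−ε·‖v‖²) ≪_d ε^{−d/2}·#H, where ‖·‖ is the Euclidean norm and ‖·‖_∞ the maximum norm. -/
open Matrix

/-- A theta series with parameter `ε ≤ 1` is `O(ε^{-1/2})`. -/
theorem exists_sum_exp_neg_mul_int_sq_le :
    ∃ C : ℝ, 0 < C ∧ ∀ ε : ℝ, 0 < ε → ε ≤ 1 → ∀ s : Finset ℤ,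
      ∑ k ∈ s, Real.exp (-(ε / 2 * (k : ℝ) ^ 2)) ≤ C * ε ^ (-(1 : ℝ) / 2) := by
  have hsum : ∀ a : ℝ, 0 < a → Summable fun n : ℤ => Real.exp (-Real.pi * a * (n : ℝ) ^ 2) := by
    intro a ha
    simpa [mul_assoc] using summable_pow_mul_jacobiTheta₂_term_bound 0 ha 0
  refine ⟨(2 * Real.pi) ^ (1 / 2 : ℝ) * ∑' n : ℤ, Real.exp (-Real.pi * (2 * Real.pi) * (n : ℝ) ^ 2),
    ?_, ?_⟩
  · refine mul_pos (by positivity) ?_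
    exact (hsum _ (by positivity)).tsum_pos (fun _ => (Real.exp_pos _).le) 0 (Real.exp_pos _)
  intro ε hε hε1 s
  have ha : 0 < ε / (2 * Real.pi) := by positivity
  have hle := (hsum _ ha).sum_le_tsum s (fun _ _ => (Real.exp_pos _).le)
  rw [Real.tsum_exp_neg_mul_int_sq ha] at hle
  have hdual : ∑' n : ℤ, Real.exp (-Real.pi / (ε / (2 * Real.pi)) * (n : ℝ) ^ 2) ≤
      ∑' n : ℤ, Real.exp (-Real.pi * (2 * Real.pi) * (n : ℝ) ^ 2) := by
    refine Summable.tsum_le_tsum (fun n => ?_) ?_ (hsum _ (by positivity))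
    · rw [Real.exp_le_exp]
      refine mul_le_mul_of_nonneg_right ?_ (sq_nonneg _)
      rw [neg_div, neg_mul, neg_le_neg_iff, div_div_eq_mul_div]
      exact (le_div_iff₀ hε).2 (mul_le_of_le_one_right (by positivity) hε1)
    · have := hsum (2 * Real.pi / ε) (by positivity)
      refine this.congr fun n => ?_
      congr 1
      field_simp
  calc ∑ k ∈ s, Real.exp (-(ε / 2 * (k : ℝ) ^ 2))
      = ∑ k ∈ s, Real.exp (-Real.pi * (ε / (2 * Real.pi)) * (k : ℝ) ^ 2) := by
        refine Finset.sum_congr rfl fun k _ => ?_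
        congr 1
        field_simp
    _ ≤ _ := hle
    _ ≤ 1 / (ε / (2 * Real.pi)) ^ (1 / 2 : ℝ) *
        ∑' n : ℤ, Real.exp (-Real.pi * (2 * Real.pi) * (n : ℝ) ^ 2) := by gcongr
    _ = _ := by
        rw [Real.div_rpow hε.le (by positivity), neg_div, Real.rpow_neg hε.le]
        field_simp

/-- Rounding a real number down to an integer changes its Gaussian weight by a bounded factor. -/
theorem exp_neg_mul_sq_le_floor {ε : ℝ} (hε : 0 < ε) (hε1 : ε ≤ 1) (x : ℝ) :
    Real.exp (-(ε * (x * x))) ≤ Real.exp 1 * Real.exp (-(ε / 2 * (⌊x⌋ : ℝ) ^ 2)) := by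
  rw [← Real.exp_add, Real.exp_le_exp]
  have h1 := Int.floor_le x
  have h2 := Int.lt_floor_add_one x
  have h3 : (⌊x⌋ : ℝ) ^ 2 ≤ 2 * (x * x) + 2 := by
    nlinarith [sq_nonneg (2 * x - (⌊x⌋ : ℝ))]
  nlinarith [mul_le_mul_of_nonneg_left h3 hε.le]

/-- Two points with the same integer part are at distance less than one. -/
theorem norm_sub_lt_one_of_floor_eq {d : ℕ} {u v : Fin d → ℝ}
    (h : (fun i => ⌊u i⌋) = fun i => ⌊v i⌋) : ‖u - v‖ < 1 :=
  (pi_norm_lt_iff one_pos).2 fun i => Int.abs_sub_lt_one_of_floor_eq_floor (congrFun h i)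

/-- Gaussian sums over finite subsets of a set closed under differences are bounded by the number
of its points in the open unit cube. -/
theorem sum_exp_neg_mul_dotProduct_le {d : ℕ} {L : Set (Fin d → ℝ)}
    (hL : ∀ u ∈ L, ∀ v ∈ L, u - v ∈ L) (hH : {v | v ∈ L ∧ ‖v‖ < 1}.Finite)
    {ε : ℝ} (hε : 0 < ε) (hε1 : ε ≤ 1) {S : ℝ}
    (hS : ∀ s : Finset ℤ, ∑ k ∈ s, Real.exp (-(ε / 2 * (k : ℝ) ^ 2)) ≤ S) (s : Finset L) :
    ∑ v ∈ s, Real.exp (-(ε * ((v : Fin d → ℝ) ⬝ᵥ (v : Fin d → ℝ)))) ≤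
      (Real.exp 1 * S) ^ d * ({v | v ∈ L ∧ ‖v‖ < 1}.ncard : ℝ) := by
  classical
  set H : Set (Fin d → ℝ) := {v | v ∈ L ∧ ‖v‖ < 1}
  let fl : L → Fin d → ℤ := fun v i => ⌊(v : Fin d → ℝ) i⌋
  let g : (Fin d → ℤ) → ℝ :=
    fun k => ∏ i, (Real.exp 1 * Real.exp (-(ε / 2 * (k i : ℝ) ^ 2)))
  have hg : ∀ k, 0 ≤ g k := fun k => Finset.prod_nonneg fun i _ => by positivity
  let T : Fin d → Finset ℤ := fun i => s.image fun v => fl v i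
  have hmaps : ∀ v ∈ s, fl v ∈ Fintype.piFinset T := fun v hv =>
    Fintype.mem_piFinset.2 fun i => Finset.mem_image_of_mem (fun v => fl v i) hv
  have hterm : ∀ v : L, Real.exp (-(ε * ((v : Fin d → ℝ) ⬝ᵥ (v : Fin d → ℝ)))) ≤ g (fl v) := by
    intro v
    rw [dotProduct, Finset.mul_sum, ← Finset.sum_neg_distrib, Real.exp_sum]
    exact Finset.prod_le_prod (fun i _ => (Real.exp_pos _).le)
      fun i _ => exp_neg_mul_sq_le_floor hε hε1 _
  have hcard : ∀ k, (s.filter fun v => fl v = k).card ≤ H.ncard := by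
    intro k
    rcases (s.filter fun v => fl v = k).eq_empty_or_nonempty with h | ⟨w, hw⟩
    · simp [h]
    rw [← Set.ncard_coe_finset]
    refine Set.ncard_le_ncard_of_injOn (fun v : L => (v : Fin d → ℝ) - w) ?_ ?_ hH
    · intro v hv
      have hv' := (Finset.mem_filter.1 (Finset.mem_coe.1 hv)).2
      have hw' := (Finset.mem_filter.1 hw).2
      exact ⟨hL _ v.2 _ w.2, norm_sub_lt_one_of_floor_eq (hv'.trans hw'.symm)⟩
    · intro u _ v _ huv
      exact Subtype.ext (sub_left_injective huv)
  calc ∑ v ∈ s, Real.exp (-(ε * ((v : Fin d → ℝ) ⬝ᵥ (v : Fin d → ℝ))))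
      ≤ ∑ v ∈ s, g (fl v) := Finset.sum_le_sum fun v _ => hterm v
    _ = ∑ k ∈ Fintype.piFinset T, ∑ v ∈ s with fl v = k, g (fl v) :=
        (Finset.sum_fiberwise_of_maps_to hmaps _).symm
    _ ≤ ∑ k ∈ Fintype.piFinset T, g k * H.ncard := by
        refine Finset.sum_le_sum fun k _ => ?_
        rw [Finset.sum_congr rfl fun v hv => congrArg g (Finset.mem_filter.1 hv).2,
          Finset.sum_const, nsmul_eq_mul, mul_comm]
        exact mul_le_mul_of_nonneg_left (Nat.cast_le.2 (hcard k)) (hg k)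
    _ = (∏ i, ∑ k ∈ T i, Real.exp 1 * Real.exp (-(ε / 2 * (k : ℝ) ^ 2))) * H.ncard := by
        rw [← Finset.sum_mul, Finset.prod_univ_sum]
    _ ≤ (∏ _i : Fin d, Real.exp 1 * S) * H.ncard := by
        refine mul_le_mul_of_nonneg_right (Finset.prod_le_prod
          (fun i _ => Finset.sum_nonneg fun k _ => by positivity) fun i _ => ?_) (Nat.cast_nonneg _)
        rw [← Finset.mul_sum]
        exact mul_le_mul_of_nonneg_left (hS _) (Real.exp_pos _).le
    _ = _ := by simp

/-- A lattice `B·ℤ^d` of full rank has finitely many points in the open unit cube. -/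
theorem finite_range_mulVec_int_norm_lt_one {d : ℕ} {B : Matrix (Fin d) (Fin d) ℝ}
    (hB : B.det ≠ 0) :
    {v | v ∈ Set.range (fun m : Fin d → ℤ => B *ᵥ fun i => (m i : ℝ)) ∧ ‖v‖ < 1}.Finite := by
  let M : Fin d → ℤ := fun i => ⌈∑ j, |B⁻¹ i j|⌉
  refine ((Set.finite_Icc (-M) M).image fun m : Fin d → ℤ => B *ᵥ fun i => (m i : ℝ)).subset ?_
  rintro _ ⟨⟨m, rfl⟩, hm⟩
  refine ⟨m, ?_, rfl⟩
  have key : ∀ i, |m i| ≤ M i := by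
    intro i
    have hinv : B⁻¹ *ᵥ (B *ᵥ fun i => (m i : ℝ)) = fun i => (m i : ℝ) := by
      rw [mulVec_mulVec, nonsing_inv_mul _ (isUnit_iff_ne_zero.2 hB), one_mulVec]
    have hi : |(m i : ℝ)| ≤ ∑ j, |B⁻¹ i j| := by
      rw [← congrFun hinv i, mulVec, dotProduct]
      refine (Finset.abs_sum_le_sum_abs _ _).trans (Finset.sum_le_sum fun j _ => ?_)
      rw [abs_mul]
      exact mul_le_of_le_one_right (abs_nonneg _) ((norm_le_pi_norm _ j).trans hm.le)
    exact_mod_cast hi.trans (Int.le_ceil _)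
  exact ⟨fun i => (abs_le.1 (key i)).1, fun i => (abs_le.1 (key i)).2⟩

/-- Lemma 4.2 of Götze–Margulis: for a full-rank lattice `Λ = B·ℤ^d` and `0 < ε ≤ 1`,
with `H = {v ∈ Λ : ‖v‖_∞ < 1}`,
`exp(−d·ε)·#H ≤ Σ_{v ∈ Λ} exp(−ε‖v‖²) ≪_d ε^{−d/2}·#H`. -/
theorem stmt8 (d : ℕ) :
    ∃ c : ℝ, 0 < c ∧
      ∀ (B : Matrix (Fin d) (Fin d) ℝ), B.det ≠ 0 →
        ∀ ε : ℝ, 0 < ε → ε ≤ 1 →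
          Real.exp (-((d : ℝ) * ε)) *
              (Set.ncard {v | v ∈ Set.range (fun m : Fin d → ℤ =>
                  B *ᵥ fun i => (m i : ℝ)) ∧ ‖v‖ < 1} : ℝ)
            ≤ (∑' v : (Set.range (fun m : Fin d → ℤ => B *ᵥ fun i => (m i : ℝ))),
                Real.exp (-(ε * ((v : Fin d → ℝ) ⬝ᵥ (v : Fin d → ℝ))))) ∧
          (∑' v : (Set.range (fun m : Fin d → ℤ => B *ᵥ fun i => (m i : ℝ))),
              Real.exp (-(ε * ((v : Fin d → ℝ) ⬝ᵥ (v : Fin d → ℝ)))))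
            ≤ c * ε ^ (-(d : ℝ)/2) *
              (Set.ncard {v | v ∈ Set.range (fun m : Fin d → ℤ =>
                  B *ᵥ fun i => (m i : ℝ)) ∧ ‖v‖ < 1} : ℝ) := by
  obtain ⟨C, hC, hbound⟩ := exists_sum_exp_neg_mul_int_sq_le
  refine ⟨(Real.exp 1 * C) ^ d, by positivity, fun B hB ε hε hε1 => ?_⟩
  have hH := finite_range_mulVec_int_norm_lt_one hB
  set L : Set (Fin d → ℝ) := Set.range fun m : Fin d → ℤ => B *ᵥ fun i => (m i : ℝ)
  have hL : ∀ u ∈ L, ∀ v ∈ L, u - v ∈ L := by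
    rintro _ ⟨m, rfl⟩ _ ⟨n, rfl⟩
    refine ⟨m - n, ?_⟩
    simp only [← mulVec_sub, Pi.sub_apply, Int.cast_sub]
    rfl
  have hle := sum_exp_neg_mul_dotProduct_le hL hH hε hε1 (hbound ε hε hε1)
  have hsummable := summable_of_sum_le (fun _ => (Real.exp_pos _).le) hle
  constructor
  · have hfin : {v : L | ‖(v : Fin d → ℝ)‖ < 1}.Finite :=
      (hH.preimage Subtype.val_injective.injOn).subset fun v hv => ⟨v.2, hv⟩
    have hcard : {v | v ∈ L ∧ ‖v‖ < 1}.ncard = hfin.toFinset.card := by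
      rw [← Set.ncard_eq_toFinset_card _ hfin,
        ← Set.ncard_image_of_injective _ Subtype.val_injective]
      congr 1
      ext v
      simp [and_comm]
    refine le_trans ?_ (hsummable.sum_le_tsum hfin.toFinset fun _ _ => (Real.exp_pos _).le)
    rw [hcard, mul_comm, ← nsmul_eq_mul]
    refine Finset.card_nsmul_le_sum _ _ _ fun v hv => ?_
    rw [Real.exp_le_exp, neg_le_neg_iff, mul_comm]
    refine mul_le_mul_of_nonneg_right ?_ hε.le
    have hv1 : ‖(v : Fin d → ℝ)‖ < 1 := hfin.mem_toFinset.1 hv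
    calc (v : Fin d → ℝ) ⬝ᵥ (v : Fin d → ℝ) ≤ ∑ _i : Fin d, (1 : ℝ) := by
          refine Finset.sum_le_sum fun i _ => ?_
          rw [← sq, sq_le_one_iff_abs_le_one]
          exact (norm_le_pi_norm _ i).trans hv1.le
      _ = d := by simp
  · refine (Real.tsum_le_of_sum_le (fun _ => (Real.exp_pos _).le) hle).trans_eq ?_
    rw [← mul_assoc, mul_pow, ← Real.rpow_natCast (ε ^ _), ← Real.rpow_mul hε.le]
    congr 3
    ring
end

section
/- Let F be a norm on ℝ^n with F(x) ≍_n ‖x‖ (Euclidean norm), let Λ ⊂ ℝ^n be a lattice of rank n, and let M_1 ≤ … ≤ M_n be the successive minima of F with respect to Λ. Then: (i) α_l(Λ) ≍_n (M_1·M_2 ⋯ M_l)^{−1} for every l = 1,…,n; and (ii) if 1 ≤ j ≤ n and μ > 0 satisfy M_j ≤ μ < M_{j+1} (with M_{n+1} = ∞), then #{v ∈ Λ : F(v) ≤ μ} ≍_n μ^j·(M_1·M_2 ⋯ M_j)^{−1}. -/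
open Matrix

noncomputable def latticeDet {ι : Type*} [Fintype ι] {l : ℕ} (v : Fin l → ι → ℝ) : ℝ :=
  Real.sqrt (Matrix.det (Matrix.of fun i j => v i ⬝ᵥ v j))

noncomputable def alphaE {ι : Type*} [Fintype ι] (l : ℕ) (Λ : Set (ι → ℝ)) : ℝ :=
  sSup {x | ∃ v : Fin l → ι → ℝ, (∀ i, v i ∈ Λ) ∧ LinearIndependent ℝ v ∧
    x = (latticeDet v)⁻¹}

/-- The `j`-th successive minimum of the norm `F` with respect to the lattice `Λ`. -/
noncomputable def succMin {ι : Type*} [Fintype ι] (F : (ι → ℝ) → ℝ)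
    (Λ : Set (ι → ℝ)) (j : ℕ) : ℝ :=
  sInf {lam | 0 < lam ∧ ∃ v : Fin j → ι → ℝ,
    (∀ i, v i ∈ Λ) ∧ (∀ i, F (v i) < lam) ∧ LinearIndependent ℝ v}

open scoped InnerProductSpace

section ReducedBasis

variable {V : Type*} [NormedAddCommGroup V] [InnerProductSpace ℝ V]

/-- The family whose `i`-th member is the combination of `v` given by the `i`-th row of `M`. -/
def rowComb {ι κ W : Type*} [Fintype κ] [AddCommMonoid W] [Module ℝ W]
    (M : Matrix ι κ ℝ) (v : κ → W) (i : ι) : W :=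
  ∑ j, M i j • v j

/-- The real matrix with the same entries as an integer matrix. -/
abbrev realMat {ι κ : Type*} (U : Matrix ι κ ℤ) : Matrix ι κ ℝ := U.map (Int.cast : ℤ → ℝ)

lemma rowComb_mul {ι κ τ W : Type*} [Fintype κ] [Fintype τ] [AddCommMonoid W] [Module ℝ W]
    (M : Matrix ι κ ℝ) (N : Matrix κ τ ℝ) (v : τ → W) :
    rowComb (M * N) v = rowComb M (rowComb N v) := by
  funext i
  simp only [rowComb, Matrix.mul_apply, Finset.sum_smul, Finset.smul_sum, mul_smul]
  exact Finset.sum_comm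

lemma rowComb_one {ι W : Type*} [Fintype ι] [DecidableEq ι] [AddCommMonoid W] [Module ℝ W]
    (v : ι → W) : rowComb (1 : Matrix ι ι ℝ) v = v := by
  funext i
  simp [rowComb, Matrix.one_apply, ite_smul]

lemma map_rowComb {ι κ W W' : Type*} [Fintype κ] [AddCommMonoid W] [Module ℝ W]
    [AddCommMonoid W'] [Module ℝ W'] (f : W →ₗ[ℝ] W') (M : Matrix ι κ ℝ) (v : κ → W) :
    f ∘ rowComb M v = rowComb M (f ∘ v) := by
  funext i
  simp [rowComb]

lemma realMat_mul {ι κ τ : Type*} [Fintype κ] (M : Matrix ι κ ℤ) (N : Matrix κ τ ℤ) :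
    realMat (M * N) = realMat M * realMat N := by
  ext i j
  simp [realMat, Matrix.mul_apply]

lemma realMat_one {ι : Type*} [DecidableEq ι] : realMat (1 : Matrix ι ι ℤ) = 1 :=
  Matrix.map_one _ Int.cast_zero Int.cast_one

lemma det_realMat {ι : Type*} [Fintype ι] [DecidableEq ι] (U : Matrix ι ι ℤ) :
    (realMat U).det = (U.det : ℝ) :=
  ((Int.castRingHom ℝ).map_det U).symm

lemma det_gram_rowComb {ι : Type*} [Fintype ι] [DecidableEq ι] (M : Matrix ι ι ℝ) (v : ι → V) :
    (gram ℝ (rowComb M v)).det = M.det ^ 2 * (gram ℝ v).det := by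
  have h : gram ℝ (rowComb M v) = M * gram ℝ v * Mᵀ := by
    ext i j
    simp only [gram_apply, rowComb, sum_inner, inner_sum, real_inner_smul_left,
      real_inner_smul_right, Matrix.mul_apply, Matrix.transpose_apply, Finset.sum_mul]
    exact Finset.sum_congr rfl fun _ _ => Finset.sum_congr rfl fun _ _ => by
      rw [real_inner_comm]; ring
  rw [h, det_mul, det_mul, det_transpose]
  ring

lemma det_gram_rowComb_realMat {ι : Type*} [Fintype ι] [DecidableEq ι] {U : Matrix ι ι ℤ}
    (hU : IsUnit U.det) (v : ι → V) :
    (gram ℝ (rowComb (realMat U) v)).det = (gram ℝ v).det := by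
  rw [det_gram_rowComb, det_realMat]
  rcases Int.isUnit_iff.1 hU with h | h <;> simp [h]

lemma det_eq_mul_of_row_zero {R : Type*} [CommRing R] {l : ℕ}
    (M : Matrix (Fin (l + 1)) (Fin (l + 1)) R) (h : ∀ j : Fin l, M 0 j.succ = 0) :
    M.det = M 0 0 * (M.submatrix Fin.succ Fin.succ).det := by
  rw [det_succ_row_zero, Fin.sum_univ_succ]
  simp [h, Fin.succAbove_zero]

/-- The block matrix with first row `(1, 0)` and remaining rows `(c i, M i)`. -/
def borderMat {R : Type*} [Zero R] [One R] {l : ℕ} (c : Fin l → R) (M : Matrix (Fin l) (Fin l) R) :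
    Matrix (Fin (l + 1)) (Fin (l + 1)) R :=
  of (Fin.cons (Fin.cons 1 0) fun i => Fin.cons (c i) (M i))

lemma det_borderMat {R : Type*} [CommRing R] {l : ℕ} (c : Fin l → R)
    (M : Matrix (Fin l) (Fin l) R) : (borderMat c M).det = M.det := by
  have h : (borderMat c M).submatrix Fin.succ Fin.succ = M := by ext i j; simp [borderMat]
  rw [det_eq_mul_of_row_zero _ fun j => by simp [borderMat], h]
  simp [borderMat]

/-- The component of a vector orthogonal to `u`. -/
noncomputable def orthComp (u : V) : V →ₗ[ℝ] V :=
  LinearMap.id - (‖u‖ ^ 2)⁻¹ • (innerₛₗ ℝ u).smulRight u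

lemma orthComp_apply (u x : V) : orthComp u x = x - (⟪u, x⟫_ℝ / ‖u‖ ^ 2) • u := by
  simp [orthComp, smul_smul, div_eq_inv_mul]

lemma orthComp_self (u : V) : orthComp u u = 0 := by
  rcases eq_or_ne u 0 with rfl | h
  · simp
  · rw [orthComp_apply, real_inner_self_eq_norm_sq, div_self (by positivity)]
    simp

lemma inner_orthComp (u x : V) : ⟪u, orthComp u x⟫_ℝ = 0 := by
  rcases eq_or_ne u 0 with rfl | h
  · simp
  · rw [orthComp_apply, inner_sub_right, real_inner_smul_right, real_inner_self_eq_norm_sq,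
      div_mul_cancel₀ _ (by positivity), sub_self]

lemma norm_sq_orthComp_add (u x : V) (t : ℝ) :
    ‖orthComp u x + t • u‖ ^ 2 = ‖orthComp u x‖ ^ 2 + t ^ 2 * ‖u‖ ^ 2 := by
  rw [norm_add_sq_real, real_inner_smul_right, real_inner_comm, inner_orthComp, norm_smul, mul_pow,
    Real.norm_eq_abs, sq_abs]
  ring

lemma norm_orthComp_le (u x : V) : ‖orthComp u x‖ ≤ ‖x‖ := by
  have h := norm_sq_orthComp_add u x (⟪u, x⟫_ℝ / ‖u‖ ^ 2)
  rw [orthComp_apply, sub_add_cancel, ← orthComp_apply] at h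
  exact le_of_sq_le_sq (by rw [h]; nlinarith [sq_nonneg (⟪u, x⟫_ℝ / ‖u‖ ^ 2 * ‖u‖)])
    (norm_nonneg _)

lemma det_gram_cons {l : ℕ} (b : Fin (l + 1) → V) :
    (gram ℝ b).det = ‖b 0‖ ^ 2 * (gram ℝ fun i : Fin l => orthComp (b 0) (b i.succ)).det := by
  set c : Fin (l + 1) → V := Fin.cons (b 0) fun i : Fin l => orthComp (b 0) (b i.succ) with hc
  set T := borderMat (fun i => ⟪b 0, b i.succ⟫_ℝ / ‖b 0‖ ^ 2) (1 : Matrix (Fin l) (Fin l) ℝ) with hT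
  have hb : b = rowComb T c := by
    funext i
    refine Fin.cases ?_ (fun i => ?_) i
    · simp [rowComb, Fin.sum_univ_succ, hT, borderMat, hc]
    · simp [rowComb, Fin.sum_univ_succ, hT, borderMat, hc, Matrix.one_apply, orthComp_apply, ite_smul]
  have hTdet : T.det = 1 := by rw [hT, det_borderMat, det_one]
  rw [hb, det_gram_rowComb, hTdet, ← hb, det_eq_mul_of_row_zero]
  · have : (gram ℝ c).submatrix Fin.succ Fin.succ =
        gram ℝ fun i : Fin l => orthComp (b 0) (b i.succ) := by ext i j; simp [hc]
    rw [this]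
    simp [hc]
  · intro j
    simp [hc, inner_orthComp]

/-- Hadamard's inequality for Gram determinants. -/
lemma det_gram_le_prod {l : ℕ} (b : Fin l → V) : (gram ℝ b).det ≤ ∏ i, ‖b i‖ ^ 2 := by
  induction l with
  | zero => simp
  | succ l ih =>
    rw [det_gram_cons, Fin.prod_univ_succ]
    gcongr
    refine (ih _).trans ?_
    gcongr
    exact norm_orthComp_le _ _

lemma exists_pos_le_norm_intComb {l : ℕ} {v : Fin l → V} (hv : LinearIndependent ℝ v) :
    ∃ c : ℝ, 0 < c ∧ ∀ a : Fin l → ℤ, a ≠ 0 → c ≤ ‖∑ i, (a i : ℝ) • v i‖ := by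
  obtain ⟨K, hK, h⟩ := (Fintype.linearCombination ℝ v).exists_antilipschitzWith
    (LinearMap.ker_eq_bot.2 (hv.fintypeLinearCombination_injective))
  refine ⟨(K : ℝ)⁻¹, by positivity, fun a ha => ?_⟩
  have h1 := h.le_mul_dist (fun i => (a i : ℝ)) 0
  rw [map_zero, dist_zero_right, dist_zero_right, Fintype.linearCombination_apply] at h1
  obtain ⟨i, hi⟩ := Function.ne_iff.1 ha
  have h2 : (1 : ℝ) ≤ ‖fun i => (a i : ℝ)‖ := by
    refine le_trans ?_ (norm_le_pi_norm _ i)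
    rw [Real.norm_eq_abs]
    exact_mod_cast Int.one_le_abs hi
  rw [inv_le_iff_one_le_mul₀' (by positivity)]
  exact h2.trans h1

lemma exists_unimodular_near_min {l : ℕ} {v : Fin (l + 1) → V} (hv : LinearIndependent ℝ v) :
    ∃ U : Matrix (Fin (l + 1)) (Fin (l + 1)) ℤ, IsUnit U.det ∧
      ∀ U' : Matrix (Fin (l + 1)) (Fin (l + 1)) ℤ, IsUnit U'.det → ∀ i,
        ‖rowComb (realMat U) v 0‖ ^ 2 ≤ 6 / 5 * ‖rowComb (realMat U') v i‖ ^ 2 := by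
  obtain ⟨c, hc, h⟩ := exists_pos_le_norm_intComb hv
  set S : Set ℝ := {x | ∃ (U : Matrix (Fin (l + 1)) (Fin (l + 1)) ℤ) (i : Fin (l + 1)),
    IsUnit U.det ∧ x = ‖rowComb (realMat U) v i‖ ^ 2} with hS
  have hlow : ∀ x ∈ S, c ^ 2 ≤ x := by
    rintro x ⟨U, i, hU, rfl⟩
    gcongr
    refine h (U i) fun h0 => hU.ne_zero (det_eq_zero_of_row_eq_zero i fun j => congrFun h0 j)
  have hne : S.Nonempty := ⟨_, 1, 0, by simp, rfl⟩
  have hbdd : BddBelow S := ⟨_, hlow⟩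
  have hpos : 0 < sInf S := lt_of_lt_of_le (by positivity) (le_csInf hne hlow)
  obtain ⟨x, ⟨U, i, hU, rfl⟩, hx⟩ := exists_lt_of_csInf_lt hne
    (show sInf S < 6 / 5 * sInf S by linarith)
  refine ⟨U.submatrix (Equiv.swap 0 i) id, ?_, fun U' hU' k => ?_⟩
  · rw [det_permute]
    exact ((Equiv.Perm.sign _).isUnit.map (Int.castRingHom ℤ)).mul hU
  · have h1 : sInf S ≤ ‖rowComb (realMat U') v k‖ ^ 2 := csInf_le hbdd ⟨U', k, hU', rfl⟩
    have h2 : rowComb (realMat (U.submatrix (Equiv.swap 0 i) id)) v 0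
        = rowComb (realMat U) v i := by simp [rowComb]
    rw [h2]
    linarith

lemma card_le_of_abs_sub_le (s : Finset ℤ) (D : ℝ) (hD : 0 ≤ D)
    (h : ∀ a ∈ s, ∀ b ∈ s, (a : ℝ) - b ≤ D) : (s.card : ℝ) ≤ 1 + D := by
  rcases s.eq_empty_or_nonempty with rfl | hs
  · simp; linarith
  · have hsub : s ⊆ Finset.Icc (s.min' hs) (s.max' hs) := fun a ha =>
      Finset.mem_Icc.2 ⟨s.min'_le a ha, s.le_max' a ha⟩
    have h1 := Finset.card_le_card hsub
    rw [Int.card_Icc] at h1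
    have h2 := h _ (s.max'_mem hs) _ (s.min'_mem hs)
    have h3 : s.min' hs ≤ s.max' hs := s.min'_le _ (s.max'_mem hs)
    have h4 : (s.card : ℤ) ≤ s.max' hs + 1 - s.min' hs := by omega
    have h5 : (s.card : ℝ) ≤ s.max' hs + 1 - s.min' hs := by exact_mod_cast h4
    linarith

lemma card_intComb_le_mul {l : ℕ} (z : Fin (l + 1) → V) (hz : z 0 ≠ 0) (N R : ℝ)
    (hR : 0 ≤ R)
    (hN : ∀ s : Finset (Fin l → ℤ),
      (∀ a ∈ s, ‖∑ i, (a i : ℝ) • orthComp (z 0) (z i.succ)‖ ≤ R) → (s.card : ℝ) ≤ N)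
    (s : Finset (Fin (l + 1) → ℤ)) (hs : ∀ a ∈ s, ‖∑ i, (a i : ℝ) • z i‖ ≤ R) :
    (s.card : ℝ) ≤ (1 + 2 * R / ‖z 0‖) * N := by
  have hz' : 0 < ‖z 0‖ := norm_pos_iff.2 hz
  have hfib : ∀ t ∈ s.image Fin.tail, (s.filter fun a => Fin.tail a = t).card
      ≤ ⌊1 + 2 * R / ‖z 0‖⌋₊ := by
    intro t _
    refine Nat.le_floor ?_
    have hinj : Set.InjOn (fun a : Fin (l + 1) → ℤ => a 0)
        (s.filter fun a => Fin.tail a = t : Finset (Fin (l + 1) → ℤ)) := by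
      intro a ha b hb hab
      simp only [Finset.coe_filter, Set.mem_ofPred_eq] at ha hb
      rw [← Fin.cons_self_tail a, ← Fin.cons_self_tail b, ha.2, hb.2]
      simp only at hab
      rw [hab]
    rw [← Finset.card_image_of_injOn hinj]
    refine card_le_of_abs_sub_le _ _ (by positivity) fun x hx y hy => ?_
    simp only [Finset.mem_image, Finset.mem_filter] at hx hy
    obtain ⟨a, ⟨ha, hat⟩, rfl⟩ := hx
    obtain ⟨b, ⟨hb, hbt⟩, rfl⟩ := hy
    have hdiff : ∑ i, (a i : ℝ) • z i - ∑ i, (b i : ℝ) • z i = ((a 0 : ℝ) - b 0) • z 0 := by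
      have : ∀ i : Fin l, a i.succ = b i.succ := fun i => congrFun (hat.trans hbt.symm) i
      simp only [Fin.sum_univ_succ, this, sub_smul]
      abel
    have h1 := norm_sub_le (∑ i, (a i : ℝ) • z i) (∑ i, (b i : ℝ) • z i)
    rw [hdiff, norm_smul] at h1
    rw [le_div_iff₀ hz']
    have := hs a ha
    have := hs b hb
    have := mul_le_mul_of_nonneg_right (le_abs_self ((a 0 : ℝ) - b 0)) hz'.le
    rw [Real.norm_eq_abs] at h1
    linarith
  have h1 := Finset.card_le_mul_card_image s _ hfib
  have h2 : ((s.image Fin.tail).card : ℝ) ≤ N := by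
    refine hN _ fun t ht => ?_
    obtain ⟨a, ha, rfl⟩ := Finset.mem_image.1 ht
    refine le_trans ?_ (hs a ha)
    refine le_trans (le_of_eq ?_) (norm_orthComp_le (z 0) _)
    congr 1
    rw [map_sum, Fin.sum_univ_succ]
    simp [orthComp_self, Fin.tail]
  calc (s.card : ℝ) ≤ (⌊1 + 2 * R / ‖z 0‖⌋₊ : ℝ) * (s.image Fin.tail).card := by exact_mod_cast h1
    _ ≤ (1 + 2 * R / ‖z 0‖) * N := by
      gcongr
      exact Nat.floor_le (by positivity)

/-- Existence of reduced bases: `r i` is the length of the `i`-th Gram-Schmidt vector of the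
reduced basis `rowComb (realMat U) v`. -/
theorem exists_reduced_basis {l : ℕ} {v : Fin l → V} (hv : LinearIndependent ℝ v) :
    ∃ (U : Matrix (Fin l) (Fin l) ℤ) (r : Fin l → ℝ), IsUnit U.det ∧ (∀ i, 0 < r i) ∧
      (∀ i k, i ≤ k → ‖rowComb (realMat U) v i‖ ≤ 2 ^ l * r k) ∧
      (gram ℝ v).det = ∏ i, r i ^ 2 ∧
      ∀ R : ℝ, 0 ≤ R → ∀ s : Finset (Fin l → ℤ),
        (∀ a ∈ s, ‖∑ i, (a i : ℝ) • rowComb (realMat U) v i‖ ≤ R) →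
        (s.card : ℝ) ≤ ∏ i, (1 + 2 * R / r i) := by
  induction l with
  | zero =>
    refine ⟨1, 1, by simp, fun i => i.elim0, fun i => i.elim0, by simp, fun R _ s _ => ?_⟩
    simpa using Finset.card_le_one_of_subsingleton s
  | succ l ih =>
    obtain ⟨U, hU, hmin⟩ := exists_unimodular_near_min hv
    set b := rowComb (realMat U) v with hb
    have hdetb : (gram ℝ b).det = (gram ℝ v).det := det_gram_rowComb_realMat hU v
    have hdetb0 : (gram ℝ b).det ≠ 0 := by
      rw [hdetb]; exact det_gram_ne_zero_iff_linearIndependent.2 hv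
    set p : Fin l → V := fun i => orthComp (b 0) (b i.succ) with hp
    rw [det_gram_cons] at hdetb0
    have hpli : LinearIndependent ℝ p :=
      det_gram_ne_zero_iff_linearIndependent.1 (right_ne_zero_of_mul hdetb0)
    have hb0 : b 0 ≠ 0 := fun h => hdetb0 (by simp [h])
    have hb0' : 0 < ‖b 0‖ := norm_pos_iff.2 hb0
    obtain ⟨U', r', hU', hr', hred, hdet, hcount⟩ := ih hpli
    set q := rowComb (realMat U') p with hq
    set y := rowComb (realMat U') (fun i : Fin l => b i.succ) with hy
    have hyq : ∀ i, orthComp (b 0) (y i) = q i := fun i =>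
      congrFun (map_rowComb (orthComp (b 0)) (realMat U') fun i : Fin l => b i.succ) i
    set k : Fin l → ℤ := fun i => round (⟪b 0, y i⟫_ℝ / ‖b 0‖ ^ 2) with hk
    set W := borderMat (fun i => -k i) U' with hW
    have hWdet : W.det = U'.det := det_borderMat _ _
    have hWU : IsUnit (W * U).det := by
      rw [det_mul, hWdet]; exact hU'.mul hU
    set z := rowComb (realMat (W * U)) v with hz
    have hzb : z = rowComb (realMat W) b := by rw [hz, realMat_mul, rowComb_mul]
    have hz0 : z 0 = b 0 := by
      rw [hzb]; simp [rowComb, Fin.sum_univ_succ, hW, borderMat]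
    have hzs : ∀ i : Fin l, z i.succ = y i - (k i : ℝ) • b 0 := by
      intro i
      rw [hzb]
      simp [rowComb, Fin.sum_univ_succ, hW, borderMat, hy]
      abel
    have hzq : ∀ i : Fin l, orthComp (z 0) (z i.succ) = q i := by
      intro i
      rw [hz0, hzs, map_sub, map_smul, orthComp_self, hyq]
      simp
    have hznorm : ∀ i : Fin l, ‖z i.succ‖ ^ 2 ≤ ‖q i‖ ^ 2 + 1 / 4 * ‖b 0‖ ^ 2 := by
      intro i
      have h1 : z i.succ
          = orthComp (b 0) (y i) + (⟪b 0, y i⟫_ℝ / ‖b 0‖ ^ 2 - (k i : ℝ)) • b 0 := by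
        rw [hzs, orthComp_apply, sub_smul]; abel
      rw [h1, norm_sq_orthComp_add, hyq]
      have h2 : (⟪b 0, y i⟫_ℝ / ‖b 0‖ ^ 2 - (k i : ℝ)) ^ 2 ≤ 1 / 4 := by
        have := abs_le.1 (abs_sub_round (⟪b 0, y i⟫_ℝ / ‖b 0‖ ^ 2))
        simp only [hk]
        nlinarith [this.1, this.2]
      gcongr
    have hb0q : ∀ i : Fin l, ‖b 0‖ ^ 2 ≤ 2 * ‖q i‖ ^ 2 := by
      intro i
      have h1 := hmin _ hWU i.succ
      have h2 := hznorm i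
      nlinarith [sq_nonneg ‖b 0‖]
    refine ⟨W * U, Fin.cons ‖b 0‖ r', hWU, ?_, ?_, ?_, ?_⟩
    · exact fun i => Fin.cases (by simpa using hb0) (by simpa using hr') i
    · intro i j
      refine Fin.cases ?_ (fun j => ?_) j
      · intro hij
        obtain rfl : i = 0 := Fin.le_zero_iff.1 hij
        change ‖z 0‖ ≤ _
        rw [hz0, Fin.cons_zero]
        exact le_mul_of_one_le_left hb0'.le (one_le_pow₀ one_le_two)
      · refine Fin.cases ?_ (fun i => ?_) i
        · intro _
          change ‖z 0‖ ≤ _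
          rw [hz0, Fin.cons_succ, pow_succ]
          have h0 : ‖b 0‖ ^ 2 ≤ (2 * ‖q j‖) ^ 2 := by nlinarith [hb0q j, sq_nonneg ‖q j‖]
          have h1 : ‖b 0‖ ≤ 2 * ‖q j‖ := le_of_sq_le_sq h0 (by positivity)
          linarith [hred j j le_rfl]
        · intro hij
          change ‖z i.succ‖ ≤ _
          rw [Fin.cons_succ, pow_succ]
          have h0 : ‖z i.succ‖ ^ 2 ≤ (2 * ‖q i‖) ^ 2 := by
            nlinarith [hb0q i, hznorm i, sq_nonneg ‖q i‖]
          have h1 : ‖z i.succ‖ ≤ 2 * ‖q i‖ := le_of_sq_le_sq h0 (by positivity)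
          linarith [hred i j (Fin.succ_le_succ_iff.1 hij)]
    · rw [← hdetb, det_gram_cons, Fin.prod_univ_succ, hdet]
      simp
    · intro R hR s hs
      rw [Fin.prod_univ_succ]
      have := card_intComb_le_mul z (by rwa [hz0]) (∏ i, (1 + 2 * R / r' i)) R hR
        (fun s hs => hcount R hR s (by simpa only [hzq] using hs)) s hs
      simpa [hz0] using this

end ReducedBasis

section SuccessiveMinima

/-- The integer combinations of `w`. -/
def intSpan {κ W : Type*} [Fintype κ] [AddCommMonoid W] [Module ℝ W] (w : κ → W) : Set W :=
  Set.range fun a : κ → ℤ => ∑ i, (a i : ℝ) • w i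

lemma exists_eq_rowComb_of_mem_intSpan {ι κ W : Type*} [Fintype κ] [AddCommMonoid W] [Module ℝ W]
    {w : κ → W} {v : ι → W} (hv : ∀ i, v i ∈ intSpan w) :
    ∃ A : Matrix ι κ ℤ, v = rowComb (realMat A) w := by
  choose A hA using hv
  exact ⟨of A, funext fun i => (hA i).symm⟩

lemma rowComb_mem_intSpan {ι κ τ W : Type*} [Fintype κ] [Fintype τ] [AddCommMonoid W] [Module ℝ W]
    {w : τ → W} {v : κ → W} (hv : ∀ i, v i ∈ intSpan w) (U : Matrix ι κ ℤ) (i : ι) :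
    rowComb (realMat U) v i ∈ intSpan w := by
  obtain ⟨A, rfl⟩ := exists_eq_rowComb_of_mem_intSpan hv
  rw [← rowComb_mul, ← realMat_mul]
  exact ⟨(U * A) i, rfl⟩

lemma sum_smul_mem_intSpan {κ τ W : Type*} [Fintype κ] [Fintype τ] [AddCommMonoid W] [Module ℝ W]
    {w : τ → W} {v : κ → W} (hv : ∀ i, v i ∈ intSpan w) (a : κ → ℤ) :
    ∑ i, (a i : ℝ) • v i ∈ intSpan w :=
  rowComb_mem_intSpan hv (of fun _ : Unit => a) ()

lemma self_mem_intSpan {κ W : Type*} [Fintype κ] [AddCommMonoid W] [Module ℝ W] (w : κ → W)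
    (i : κ) : w i ∈ intSpan w := by
  classical
  have h : (rowComb (realMat (1 : Matrix κ κ ℤ)) w) i = w i := by rw [realMat_one, rowComb_one]
  exact ⟨(1 : Matrix κ κ ℤ) i, h⟩

lemma intSpan_rowComb {κ W : Type*} [Fintype κ] [DecidableEq κ] [AddCommMonoid W] [Module ℝ W]
    (w : κ → W) {U : Matrix κ κ ℤ} (hU : IsUnit U.det) :
    intSpan (rowComb (realMat U) w) = intSpan w := by
  have hw : w = rowComb (realMat U⁻¹) (rowComb (realMat U) w) := by
    rw [← rowComb_mul, ← realMat_mul, nonsing_inv_mul _ hU, realMat_one, rowComb_one]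
  refine Set.Subset.antisymm ?_ ?_
  · rintro _ ⟨a, rfl⟩
    exact sum_smul_mem_intSpan (rowComb_mem_intSpan (self_mem_intSpan w) U) a
  · rintro _ ⟨a, rfl⟩
    refine sum_smul_mem_intSpan (fun i => ?_) a
    conv => enter [2]; rw [hw]
    exact rowComb_mem_intSpan (self_mem_intSpan _) _ _

lemma prod_Icc_one_eq_prod_fin {R : Type*} [CommMonoid R] (f : ℕ → R) (l : ℕ) :
    ∏ i ∈ Finset.Icc 1 l, f i = ∏ i : Fin l, f (i + 1) := by
  induction l with
  | zero => simp
  | succ l ih => rw [Finset.prod_Icc_succ_top (by omega), ih, Fin.prod_univ_castSucc]; simp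

/-- The Euclidean norm on `ι → ℝ`. -/
noncomputable def euclNorm {ι : Type*} [Fintype ι] (x : ι → ℝ) : ℝ := ‖WithLp.toLp 2 x‖

/-- `F` is a norm comparable to the Euclidean norm with constants `κ₁`, `κ₂`. -/
structure IsComparableNorm {ι : Type*} [Fintype ι] (κ₁ κ₂ : ℝ) (F : (ι → ℝ) → ℝ) : Prop where
  add_le : ∀ x y, F (x + y) ≤ F x + F y
  smul_eq : ∀ (a : ℝ) x, F (a • x) = |a| * F x
  lower : ∀ x, κ₁ * euclNorm x ≤ F x
  upper : ∀ x, F x ≤ κ₂ * euclNorm x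

section Euclidean

variable {ι : Type*}

lemma linearIndependent_toLp {κ : Type*} {v : κ → ι → ℝ} :
    LinearIndependent ℝ (fun i => WithLp.toLp 2 (v i)) ↔ LinearIndependent ℝ v :=
  (WithLp.linearEquiv 2 ℝ (ι → ℝ)).symm.toLinearMap.linearIndependent_iff
    (LinearEquiv.ker _)

lemma toLp_rowComb {κ τ : Type*} [Fintype κ] (M : Matrix τ κ ℝ) (v : κ → ι → ℝ) (i : τ) :
    WithLp.toLp 2 (rowComb M v i) = rowComb M (fun i => WithLp.toLp 2 (v i)) i :=
  congrFun (map_rowComb (WithLp.linearEquiv 2 ℝ (ι → ℝ)).symm.toLinearMap M v) i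

lemma toLp_sum_smul {κ : Type*} [Fintype κ] (a : κ → ℝ) (v : κ → ι → ℝ) :
    WithLp.toLp 2 (∑ i, a i • v i) = ∑ i, a i • WithLp.toLp 2 (v i) :=
  toLp_rowComb (of fun _ : Unit => a) v ()

variable [Fintype ι]

lemma sqrt_dotProduct_self (x : ι → ℝ) : √(x ⬝ᵥ x) = euclNorm x := by
  rw [euclNorm, EuclideanSpace.norm_eq]
  simp [dotProduct, pow_two]

lemma latticeDet_eq {l : ℕ} (v : Fin l → ι → ℝ) :
    latticeDet v = √(gram ℝ fun i => WithLp.toLp 2 (v i)).det := by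
  unfold latticeDet
  congr 2
  ext i j
  simp [EuclideanSpace.inner_toLp_toLp, dotProduct_comm]

lemma latticeDet_le_prod {l : ℕ} (v : Fin l → ι → ℝ) : latticeDet v ≤ ∏ i, euclNorm (v i) := by
  rw [latticeDet_eq]
  refine Real.sqrt_le_iff.2 ⟨Finset.prod_nonneg fun _ _ => norm_nonneg _, ?_⟩
  rw [← Finset.prod_pow]
  exact det_gram_le_prod _

lemma exists_reduced_basis_pi {l : ℕ} {v : Fin l → ι → ℝ} (hv : LinearIndependent ℝ v) :
    ∃ (U : Matrix (Fin l) (Fin l) ℤ) (r : Fin l → ℝ), IsUnit U.det ∧ (∀ i, 0 < r i) ∧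
      (∀ i k, i ≤ k → euclNorm (rowComb (realMat U) v i) ≤ 2 ^ l * r k) ∧
      latticeDet v = ∏ i, r i ∧
      ∀ R : ℝ, 0 ≤ R → ∀ s : Finset (Fin l → ℤ),
        (∀ a ∈ s, euclNorm (∑ i, (a i : ℝ) • rowComb (realMat U) v i) ≤ R) →
        (s.card : ℝ) ≤ ∏ i, (1 + 2 * R / r i) := by
  obtain ⟨U, r, hU, hr, hred, hdet, hcount⟩ := exists_reduced_basis ((linearIndependent_toLp (v := v)).2 hv)
  refine ⟨U, r, hU, hr, ?_, ?_, ?_⟩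
  · simpa only [euclNorm, toLp_rowComb] using hred
  · rw [latticeDet_eq, hdet, Finset.prod_pow,
      Real.sqrt_sq (Finset.prod_nonneg fun i _ => (hr i).le)]
  · simpa only [euclNorm, toLp_sum_smul, toLp_rowComb] using hcount

end Euclidean

section Minima

variable {n : ℕ} {κ₁ κ₂ : ℝ} {F : (Fin n → ℝ) → ℝ} {w : Fin n → Fin n → ℝ}

lemma IsComparableNorm.sum_le (hF : IsComparableNorm κ₁ κ₂ F) {κ : Type*} (s : Finset κ)
    (x : κ → Fin n → ℝ) : F (∑ i ∈ s, x i) ≤ ∑ i ∈ s, F (x i) :=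
  Finset.le_sum_of_subadditive F (by simpa using (hF.smul_eq 0 0).le) hF.add_le s x

lemma succMin_le {Λ : Set (Fin n → ℝ)} {j : ℕ} {t : ℝ} (ht : 0 < t) {v : Fin j → Fin n → ℝ}
    (hv : ∀ i, v i ∈ Λ) (hF : ∀ i, F (v i) < t) (hli : LinearIndependent ℝ v) :
    succMin F Λ j ≤ t :=
  csInf_le ⟨0, fun _ h => h.1.le⟩ ⟨ht, v, hv, hF, hli⟩

lemma succMin_set_nonempty (hw : LinearIndependent ℝ w) (F : (Fin n → ℝ) → ℝ) {j : ℕ}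
    (hj : j ≤ n) :
    {t : ℝ | 0 < t ∧ ∃ v : Fin j → Fin n → ℝ, (∀ i, v i ∈ intSpan w) ∧ (∀ i, F (v i) < t) ∧
      LinearIndependent ℝ v}.Nonempty := by
  refine ⟨1 + ∑ i, |F (w i)|, by positivity, w ∘ Fin.castLE hj,
    fun i => self_mem_intSpan w _, fun i => ?_, hw.comp _ (Fin.castLE_injective hj)⟩
  have h1 := Finset.single_le_sum (f := fun i => |F (w i)|) (fun i _ => abs_nonneg _)
    (Finset.mem_univ (Fin.castLE hj i))
  have h2 := le_abs_self (F (w (Fin.castLE hj i)))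
  simp only [Function.comp_apply] at *
  linarith

lemma succMin_pos (hw : LinearIndependent ℝ w) (hκ₁ : 0 < κ₁) (hF : IsComparableNorm κ₁ κ₂ F)
    {j : ℕ} (hj : 1 ≤ j) (hjn : j ≤ n) : 0 < succMin F (intSpan w) j := by
  obtain ⟨c, hc, h⟩ := exists_pos_le_norm_intComb ((linearIndependent_toLp (v := w)).2 hw)
  refine lt_of_lt_of_le (mul_pos hκ₁ hc) (le_csInf (succMin_set_nonempty hw F hjn) ?_)
  rintro t ⟨-, v, hv, hvt, hli⟩
  obtain ⟨a, ha⟩ := hv ⟨0, hj⟩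
  have hne := hli.ne_zero ⟨0, hj⟩
  have h1 := h a (by rintro rfl; exact hne (by rw [← ha]; simp))
  rw [← toLp_sum_smul] at h1
  simp only at ha
  rw [ha] at h1
  exact ((mul_le_mul_of_nonneg_left h1 hκ₁.le).trans (hF.lower _)).trans (hvt _).le

lemma succMin_mono (hw : LinearIndependent ℝ w) (F : (Fin n → ℝ) → ℝ) {i j : ℕ} (hij : i ≤ j)
    (hjn : j ≤ n) : succMin F (intSpan w) i ≤ succMin F (intSpan w) j := by
  refine csInf_le_csInf ⟨0, fun _ h => h.1.le⟩ (succMin_set_nonempty hw F hjn) ?_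
  rintro t ⟨ht, v, hv, hvt, hli⟩
  exact ⟨ht, v ∘ Fin.castLE hij, fun _ => hv _, fun _ => hvt _,
    hli.comp _ (Fin.castLE_injective hij)⟩

lemma exists_near_minimal (hw : LinearIndependent ℝ w) (hκ₁ : 0 < κ₁)
    (hF : IsComparableNorm κ₁ κ₂ F) {l : ℕ} (hl : l ≤ n) :
    ∃ v : Fin l → Fin n → ℝ, (∀ i, v i ∈ intSpan w) ∧
      (∀ i : Fin l, F (v i) < 2 * succMin F (intSpan w) (i + 1)) ∧ LinearIndependent ℝ v := by
  induction l with
  | zero => exact ⟨0, fun i => i.elim0, fun i => i.elim0, linearIndependent_empty_type⟩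
  | succ l ih =>
    obtain ⟨v, hv, hvF, hli⟩ := ih (by omega)
    have hpos := succMin_pos hw hκ₁ hF (Nat.le_add_left 1 l) hl
    obtain ⟨t, ⟨-, u, hu, hut, huli⟩, ht⟩ := exists_lt_of_csInf_lt (succMin_set_nonempty hw F hl)
      (show succMin F (intSpan w) (l + 1) < 2 * succMin F (intSpan w) (l + 1) by linarith)
    obtain ⟨k, hk⟩ : ∃ k, u k ∉ Submodule.span ℝ (Set.range v) := by
      by_contra! h
      have h1 := Submodule.finrank_mono (Submodule.span_le.2 (Set.range_subset_iff.2 h))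
      rw [finrank_span_eq_card hli, finrank_span_eq_card huli] at h1
      simp at h1
    refine ⟨Fin.snoc v (u k), ?_, ?_, linearIndependent_finSnoc.2 ⟨hli, hk⟩⟩
    · refine Fin.lastCases (by simpa using hu k) fun i => ?_
      simpa using hv i
    · refine Fin.lastCases ?_ fun i => ?_
      · simpa using (hut k).trans ht
      · simpa using hvF i

lemma succMin_le_of_reduced (hF : IsComparableNorm κ₁ κ₂ F) (hκ₂ : 0 < κ₂) {l : ℕ} (hl : l ≤ n)
    {b : Fin l → Fin n → ℝ} (hb : ∀ i, b i ∈ intSpan w) (hli : LinearIndependent ℝ b)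
    {r : Fin l → ℝ} (hr : ∀ i, 0 < r i)
    (hred : ∀ i k, i ≤ k → euclNorm (b i) ≤ 2 ^ l * r k) (k : Fin l) :
    succMin F (intSpan w) (k + 1) ≤ 2 ^ (n + 1) * κ₂ * r k := by
  have hk : (k : ℕ) + 1 ≤ l := k.2
  have hrk := hr k
  refine succMin_le (v := b ∘ Fin.castLE hk) (by positivity) (fun _ => hb _) (fun i => ?_)
    (hli.comp _ (Fin.castLE_injective hk))
  have hik : Fin.castLE hk i ≤ k := by
    rw [Fin.le_def, Fin.val_castLE]; omega
  calc F (b (Fin.castLE hk i)) ≤ κ₂ * euclNorm (b (Fin.castLE hk i)) := hF.upper _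
    _ ≤ κ₂ * (2 ^ l * r k) := by gcongr; exact hred _ _ hik
    _ < κ₂ * (2 ^ (n + 1) * r k) := by gcongr <;> [norm_num; omega]
    _ = 2 ^ (n + 1) * κ₂ * r k := by ring

lemma linearIndependent_rowComb {l : ℕ} {v : Fin l → Fin n → ℝ} (hv : LinearIndependent ℝ v)
    {U : Matrix (Fin l) (Fin l) ℤ} (hU : IsUnit U.det) :
    LinearIndependent ℝ (rowComb (realMat U) v) := by
  rw [← linearIndependent_toLp, ← det_gram_ne_zero_iff_linearIndependent] at hv ⊢
  simpa only [toLp_rowComb, det_gram_rowComb_realMat hU] using hv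

lemma latticeDet_pos {l : ℕ} {v : Fin l → Fin n → ℝ} (hv : LinearIndependent ℝ v) :
    0 < latticeDet v := by
  obtain ⟨U, r, -, hr, -, hdet, -⟩ := exists_reduced_basis_pi hv
  rw [hdet]
  exact Finset.prod_pos fun i _ => hr i

/-- Minkowski's second theorem, hard direction, for sublattices. -/
lemma prod_succMin_le_latticeDet (hw : LinearIndependent ℝ w) (hκ₁ : 0 < κ₁) (hκ₂ : 0 < κ₂)
    (hF : IsComparableNorm κ₁ κ₂ F) {l : ℕ} (hl : l ≤ n) {v : Fin l → Fin n → ℝ}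
    (hv : ∀ i, v i ∈ intSpan w) (hli : LinearIndependent ℝ v) :
    ∏ i : Fin l, succMin F (intSpan w) (i + 1) ≤ (2 ^ (n + 1) * κ₂) ^ l * latticeDet v := by
  obtain ⟨U, r, hU, hr, hred, hdet, -⟩ := exists_reduced_basis_pi hli
  have h := succMin_le_of_reduced hF hκ₂ hl (rowComb_mem_intSpan hv U)
    (linearIndependent_rowComb hli hU) hr hred
  calc ∏ i : Fin l, succMin F (intSpan w) (i + 1)
      ≤ ∏ i : Fin l, (2 ^ (n + 1) * κ₂ * r i) :=
        Finset.prod_le_prod (fun i _ => (succMin_pos hw hκ₁ hF (by omega) (by omega)).le)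
          fun i _ => h i
    _ = _ := by rw [Finset.prod_mul_distrib, hdet]; simp

lemma isLUB_alphaE_and_le (hw : LinearIndependent ℝ w) (hκ₁ : 0 < κ₁) (hκ₂ : 0 < κ₂)
    (hF : IsComparableNorm κ₁ κ₂ F) {l : ℕ} (hl : l ≤ n) :
    IsLUB {x | ∃ v : Fin l → Fin n → ℝ, (∀ i, v i ∈ intSpan w) ∧ LinearIndependent ℝ v ∧
      x = (latticeDet v)⁻¹} (alphaE l (intSpan w)) ∧
    alphaE l (intSpan w)
      ≤ (2 ^ (n + 1) * κ₂) ^ l * (∏ i : Fin l, succMin F (intSpan w) (i + 1))⁻¹ := by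
  have hpos : 0 < ∏ i : Fin l, succMin F (intSpan w) (i + 1) :=
    Finset.prod_pos fun i _ => succMin_pos hw hκ₁ hF (by omega) (by omega)
  have hub : ∀ x ∈ {x | ∃ v : Fin l → Fin n → ℝ, (∀ i, v i ∈ intSpan w) ∧
      LinearIndependent ℝ v ∧ x = (latticeDet v)⁻¹},
      x ≤ (2 ^ (n + 1) * κ₂) ^ l * (∏ i : Fin l, succMin F (intSpan w) (i + 1))⁻¹ := by
    rintro x ⟨v, hv, hli, rfl⟩
    have h := prod_succMin_le_latticeDet hw hκ₁ hκ₂ hF hl hv hli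
    rw [← div_eq_mul_inv, inv_le_comm₀ (latticeDet_pos hli) (by positivity), inv_div,
      div_le_iff₀' (by positivity)]
    exact h
  obtain ⟨v, hv, -, hli⟩ := exists_near_minimal hw hκ₁ hF hl
  have hne : {x | ∃ v : Fin l → Fin n → ℝ, (∀ i, v i ∈ intSpan w) ∧
      LinearIndependent ℝ v ∧ x = (latticeDet v)⁻¹}.Nonempty := ⟨_, v, hv, hli, rfl⟩
  exact ⟨isLUB_csSup hne ⟨_, hub⟩, csSup_le hne hub⟩

lemma le_alphaE (hw : LinearIndependent ℝ w) (hκ₁ : 0 < κ₁) (hκ₂ : 0 < κ₂)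
    (hF : IsComparableNorm κ₁ κ₂ F) {l : ℕ} (hl : l ≤ n) :
    (κ₁ / 2) ^ l * (∏ i : Fin l, succMin F (intSpan w) (i + 1))⁻¹ ≤ alphaE l (intSpan w) := by
  obtain ⟨v, hv, hvF, hli⟩ := exists_near_minimal hw hκ₁ hF hl
  refine le_trans ?_ ((isLUB_alphaE_and_le hw hκ₁ hκ₂ hF hl).1.1 ⟨v, hv, hli, rfl⟩)
  have h1 : latticeDet v ≤ ∏ i : Fin l, ((κ₁ / 2)⁻¹ * succMin F (intSpan w) (i + 1)) := by
    refine (latticeDet_le_prod v).trans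
      (Finset.prod_le_prod (fun _ _ => norm_nonneg _) fun i _ => ?_)
    rw [← div_eq_inv_mul, le_div_iff₀ (by positivity)]
    linarith [hF.lower (v i), hvF i]
  have h2 := inv_anti₀ (latticeDet_pos hli) h1
  rw [Finset.prod_mul_distrib, Finset.prod_const, Finset.card_univ, Fintype.card_fin, mul_inv,
    inv_pow, inv_inv] at h2
  exact h2

lemma finite_and_ncard_le (hw : LinearIndependent ℝ w) (hκ₁ : 0 < κ₁) (hκ₂ : 0 < κ₂)
    (hF : IsComparableNorm κ₁ κ₂ F) {μ : ℝ} (hμ : 0 < μ) :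
    {x | x ∈ intSpan w ∧ F x ≤ μ}.Finite ∧ ({x | x ∈ intSpan w ∧ F x ≤ μ}.ncard : ℝ)
      ≤ ∏ i : Fin n, (1 + 2 * (2 ^ (n + 1) * κ₂) / κ₁ * (μ / succMin F (intSpan w) (i + 1))) := by
  obtain ⟨U, r, hU, hr, hred, -, hcount⟩ := exists_reduced_basis_pi hw
  have hM := succMin_le_of_reduced hF hκ₂ le_rfl (rowComb_mem_intSpan (self_mem_intSpan w) U)
    (linearIndependent_rowComb hw hU) hr hred
  set S : Set (Fin n → ℝ) := {x | x ∈ intSpan w ∧ F x ≤ μ} with hS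
  set N := ∏ i : Fin n,
    (1 + 2 * (2 ^ (n + 1) * κ₂) / κ₁ * (μ / succMin F (intSpan w) (i + 1))) with hN
  have hcard : ∀ s : Finset (Fin n → ℝ), (s : Set (Fin n → ℝ)) ⊆ S → (s.card : ℝ) ≤ N := by
    intro s hs
    have hcoef : ∀ x : s, ∃ a : Fin n → ℤ,
        ∑ i, (a i : ℝ) • rowComb (realMat U) w i = (x : Fin n → ℝ) := by
      intro x
      have h := (hs x.2).1
      rwa [← intSpan_rowComb w hU] at h
    choose g hg using hcoef
    have hinj : Function.Injective g := fun x y hxy => Subtype.ext (by rw [← hg x, ← hg y, hxy])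
    have h1 : ((s.attach.image g).card : ℝ) ≤ ∏ i, (1 + 2 * (μ / κ₁) / r i) := by
      refine hcount _ (by positivity) _ fun a ha => ?_
      obtain ⟨x, -, rfl⟩ := Finset.mem_image.1 ha
      rw [hg, le_div_iff₀' hκ₁]
      exact (hF.lower _).trans (hs x.2).2
    rw [Finset.card_image_of_injective _ hinj, Finset.card_attach] at h1
    refine h1.trans (Finset.prod_le_prod (fun i _ => ?_) fun i _ => ?_)
    · have := hr i
      positivity
    · have hri := hr i
      have hMi := succMin_pos hw hκ₁ hF (show 1 ≤ (i : ℕ) + 1 by omega) (by omega)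
      have h2 : (r i)⁻¹ ≤ 2 ^ (n + 1) * κ₂ / succMin F (intSpan w) (i + 1) := by
        rw [inv_le_comm₀ hri (by positivity), inv_div, div_le_iff₀' (by positivity)]
        exact hM i
      calc 1 + 2 * (μ / κ₁) / r i = 1 + 2 * (μ / κ₁) * (r i)⁻¹ := by rw [div_eq_mul_inv]
        _ ≤ 1 + 2 * (μ / κ₁) * (2 ^ (n + 1) * κ₂ / succMin F (intSpan w) (i + 1)) := by gcongr
        _ = _ := by ring
  have hfin : S.Finite := by
    by_contra hinf
    obtain ⟨t, ht, htc⟩ := Set.Infinite.exists_subset_card_eq hinf (⌊N⌋₊ + 1)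
    have h1 := hcard t ht
    rw [htc] at h1
    push_cast at h1
    linarith [Nat.lt_floor_add_one N]
  refine ⟨hfin, ?_⟩
  rw [Set.ncard_eq_toFinset_card S hfin]
  exact hcard _ (by simp)

lemma ncard_le (hw : LinearIndependent ℝ w) (hκ₁ : 0 < κ₁) (hκ₂ : 0 < κ₂)
    (hF : IsComparableNorm κ₁ κ₂ F) {μ : ℝ} (hμ : 0 < μ) {j : ℕ} (hjn : j ≤ n)
    (hle : succMin F (intSpan w) j ≤ μ) (hlt : j < n → μ < succMin F (intSpan w) (j + 1)) :
    ({x | x ∈ intSpan w ∧ F x ≤ μ}.ncard : ℝ) ≤ (1 + 2 * (2 ^ (n + 1) * κ₂) / κ₁) ^ n *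
      (μ ^ j * (∏ i ∈ Finset.Icc 1 j, succMin F (intSpan w) i)⁻¹) := by
  refine (finite_and_ncard_le hw hκ₁ hκ₂ hF hμ).2.trans ?_
  set D := 2 * (2 ^ (n + 1) * κ₂) / κ₁ with hD
  have hD0 : 0 ≤ D := by positivity
  rw [← prod_Icc_one_eq_prod_fin fun i => 1 + D * (μ / succMin F (intSpan w) i)]
  calc ∏ i ∈ Finset.Icc 1 n, (1 + D * (μ / succMin F (intSpan w) i))
      ≤ ∏ i ∈ Finset.Icc 1 n, ((1 + D) * if i ≤ j then μ / succMin F (intSpan w) i else 1) := by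
        refine Finset.prod_le_prod (fun i hi => ?_) fun i hi => ?_
        all_goals
          have hi' := Finset.mem_Icc.1 hi
          have hMi := succMin_pos hw hκ₁ hF hi'.1 hi'.2
        · positivity
        · split_ifs with hij
          · have h1 : 1 ≤ μ / succMin F (intSpan w) i := by
              rw [one_le_div hMi]
              exact (succMin_mono hw F hij hjn).trans hle
            linarith
          · have h1 : μ / succMin F (intSpan w) i ≤ 1 := by
              rw [div_le_one hMi]
              exact (hlt (by omega)).le.trans (succMin_mono hw F (by omega) hi'.2)
            nlinarith
    _ = (1 + D) ^ n * ∏ i ∈ Finset.Icc 1 j, μ / succMin F (intSpan w) i := by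
        rw [Finset.prod_mul_distrib, Finset.prod_const, Nat.card_Icc, Nat.add_sub_cancel]
        congr 1
        rw [← Finset.prod_subset (Finset.Icc_subset_Icc_right hjn)
          (fun i hi hij => if_neg fun h =>
            hij (Finset.mem_Icc.2 ⟨(Finset.mem_Icc.1 hi).1, h⟩))]
        exact Finset.prod_congr rfl fun i hi => if_pos (Finset.mem_Icc.1 hi).2
    _ = _ := by
        rw [Finset.prod_div_distrib, Finset.prod_const, Nat.card_Icc, Nat.add_sub_cancel,
          div_eq_mul_inv]

lemma le_ncard (hw : LinearIndependent ℝ w) (hκ₁ : 0 < κ₁) (hκ₂ : 0 < κ₂)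
    (hF : IsComparableNorm κ₁ κ₂ F) {μ : ℝ} (hμ : 0 < μ) {j : ℕ} (hj : 1 ≤ j) (hjn : j ≤ n) :
    (1 / (2 * n : ℝ)) ^ j * (μ ^ j * (∏ i : Fin j, succMin F (intSpan w) (i + 1))⁻¹)
      ≤ ({x | x ∈ intSpan w ∧ F x ≤ μ}.ncard : ℝ) := by
  have hn : (0 : ℝ) < n := by exact_mod_cast hj.trans hjn
  obtain ⟨v, hv, hvF, hli⟩ := exists_near_minimal hw hκ₁ hF hjn
  have hpos : ∀ k : Fin j, 0 < succMin F (intSpan w) (k + 1) := fun k =>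
    succMin_pos hw hκ₁ hF (by omega) (by omega)
  set N : Fin j → ℕ := fun k => ⌊μ / (2 * n * succMin F (intSpan w) (k + 1))⌋₊ with hN
  set T : Finset (Fin j → ℕ) := Fintype.piFinset fun k => Finset.range (N k + 1) with hT
  set f : (Fin j → ℕ) → Fin n → ℝ := fun t => ∑ k, (t k : ℝ) • v k with hf
  have hinj : Function.Injective f := by
    intro s t hst
    have h := hli.fintypeLinearCombination_injective
      (a₁ := fun k => (s k : ℝ)) (a₂ := fun k => (t k : ℝ))
      (by simpa [Fintype.linearCombination_apply] using hst)
    funext k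
    exact_mod_cast congrFun h k
  have hsub : ((T.image f : Finset (Fin n → ℝ)) : Set (Fin n → ℝ)) ⊆
      {x | x ∈ intSpan w ∧ F x ≤ μ} := by
    intro x hx
    obtain ⟨t, ht, rfl⟩ := Finset.mem_image.1 (Finset.mem_coe.1 hx)
    refine ⟨?_, ?_⟩
    · simpa using sum_smul_mem_intSpan hv fun k => (t k : ℤ)
    · have hk : ∀ k, F ((t k : ℝ) • v k) ≤ μ / n := by
        intro k
        have h1 : t k ≤ N k := Nat.lt_succ_iff.1 (Finset.mem_range.1 (Fintype.mem_piFinset.1 ht k))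
        have h2 : (t k : ℝ) ≤ μ / (2 * n * succMin F (intSpan w) (k + 1)) :=
          (Nat.cast_le.2 h1).trans (Nat.floor_le (by have := hpos k; positivity))
        have hk := hpos k
        rw [hF.smul_eq, Nat.abs_cast]
        calc (t k : ℝ) * F (v k) ≤ (t k : ℝ) * (2 * succMin F (intSpan w) (k + 1)) := by
              gcongr; exact (hvF k).le
          _ ≤ μ / (2 * n * succMin F (intSpan w) (k + 1)) *
              (2 * succMin F (intSpan w) (k + 1)) := by gcongr
          _ = μ / n := by field_simp
      calc F (f t) ≤ ∑ k, F ((t k : ℝ) • v k) := hF.sum_le _ _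
        _ ≤ ∑ _k : Fin j, μ / n := Finset.sum_le_sum fun k _ => hk k
        _ = j * (μ / n) := by simp
        _ ≤ n * (μ / n) := by gcongr
        _ = μ := by field_simp
  have h1 := Set.ncard_le_ncard hsub (finite_and_ncard_le hw hκ₁ hκ₂ hF hμ).1
  rw [Set.ncard_coe_finset, Finset.card_image_of_injective _ hinj, Fintype.card_piFinset] at h1
  simp only [Finset.card_range] at h1
  calc (1 / (2 * n : ℝ)) ^ j * (μ ^ j * (∏ i : Fin j, succMin F (intSpan w) (i + 1))⁻¹)
      = ∏ k : Fin j, μ / (2 * n * succMin F (intSpan w) (k + 1)) := by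
        rw [Finset.prod_div_distrib, Finset.prod_mul_distrib]
        simp only [Finset.prod_const, Finset.card_univ, Fintype.card_fin]
        rw [div_eq_mul_inv (μ ^ j), mul_inv, one_div, inv_pow]
        ring
    _ ≤ ∏ k : Fin j, ((N k + 1 : ℕ) : ℝ) := by
        refine Finset.prod_le_prod (fun k _ => ?_) fun k _ => ?_
        · have := hpos k
          positivity
        · push_cast
          exact (Nat.lt_floor_add_one _).le
    _ = ((∏ k : Fin j, (N k + 1) : ℕ) : ℝ) := by push_cast; rfl
    _ ≤ _ := by exact_mod_cast h1

lemma range_mulVec_eq_intSpan (B : Matrix (Fin n) (Fin n) ℝ) :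
    (Set.range fun m : Fin n → ℤ => B *ᵥ fun i => (m i : ℝ)) = intSpan B.col := by
  unfold intSpan
  congr 1
  funext m k
  simp [mulVec, dotProduct, mul_comm]

end Minima

end SuccessiveMinima

/-- Lemma 5.4 of Götze–Margulis: for a norm `F ≍_n ‖·‖` and a rank-`n` lattice `Λ` with
successive minima `M_1 ≤ … ≤ M_n`: (i) `α_l(Λ) ≍_n (M_1⋯M_l)⁻¹`; (ii) if
`M_j ≤ μ < M_{j+1}` then `#{v ∈ Λ : F(v) ≤ μ} ≍_n μ^j (M_1⋯M_j)⁻¹`. -/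
theorem stmt9 (n : ℕ) (hn : 1 ≤ n) (κ₁ κ₂ : ℝ) (hκ₁ : 0 < κ₁) (hκ₂ : 0 < κ₂) :
    ∃ c C : ℝ, 0 < c ∧ 0 < C ∧
      ∀ (F : (Fin n → ℝ) → ℝ) (B : Matrix (Fin n) (Fin n) ℝ), B.det ≠ 0 →
        (∀ x y : Fin n → ℝ, F (x + y) ≤ F x + F y) →
        (∀ (a : ℝ) (x : Fin n → ℝ), F (a • x) = |a| * F x) →
        (∀ x : Fin n → ℝ, F x = 0 ↔ x = 0) →
        (∀ x : Fin n → ℝ, κ₁ * Real.sqrt (x ⬝ᵥ x) ≤ F x ∧ F x ≤ κ₂ * Real.sqrt (x ⬝ᵥ x)) →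
        (∀ l : ℕ, 1 ≤ l → l ≤ n →
          c * (∏ i ∈ Finset.Icc 1 l,
              succMin F (Set.range fun m : Fin n → ℤ => B *ᵥ fun i => (m i : ℝ)) i)⁻¹
            ≤ alphaE l (Set.range fun m : Fin n → ℤ => B *ᵥ fun i => (m i : ℝ)) ∧
          alphaE l (Set.range fun m : Fin n → ℤ => B *ᵥ fun i => (m i : ℝ))
            ≤ C * (∏ i ∈ Finset.Icc 1 l,
              succMin F (Set.range fun m : Fin n → ℤ => B *ᵥ fun i => (m i : ℝ)) i)⁻¹) ∧
        (∀ (j : ℕ) (μ : ℝ), 1 ≤ j → j ≤ n → 0 < μ →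
          succMin F (Set.range fun m : Fin n → ℤ => B *ᵥ fun i => (m i : ℝ)) j ≤ μ →
          (j < n → μ < succMin F
            (Set.range fun m : Fin n → ℤ => B *ᵥ fun i => (m i : ℝ)) (j + 1)) →
          c * (μ ^ j * (∏ i ∈ Finset.Icc 1 j,
              succMin F (Set.range fun m : Fin n → ℤ => B *ᵥ fun i => (m i : ℝ)) i)⁻¹)
            ≤ (Set.ncard {v | v ∈ (Set.range fun m : Fin n → ℤ =>
                B *ᵥ fun i => (m i : ℝ)) ∧ F v ≤ μ} : ℝ) ∧
          (Set.ncard {v | v ∈ (Set.range fun m : Fin n → ℤ =>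
              B *ᵥ fun i => (m i : ℝ)) ∧ F v ≤ μ} : ℝ)
            ≤ C * (μ ^ j * (∏ i ∈ Finset.Icc 1 j,
              succMin F (Set.range fun m : Fin n → ℤ => B *ᵥ fun i => (m i : ℝ)) i)⁻¹)) := by
  set K := 2 ^ (n + 1) * κ₂ with hK
  set D := 1 + 2 * K / κ₁ with hD
  have hn' : (1 : ℝ) ≤ n := by exact_mod_cast hn
  have hK0 : 0 < K := by positivity
  have hD0 : 0 < D := by positivity
  refine ⟨min (min 1 (κ₁ / 2) ^ n) ((1 / (2 * n : ℝ)) ^ n), max (max 1 K ^ n) (D ^ n),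
    by positivity, by positivity, ?_⟩
  intro F B hB hadd hsmul _ hcomp
  have hF : IsComparableNorm κ₁ κ₂ F := by
    refine ⟨hadd, hsmul, fun x => ?_, fun x => ?_⟩
    · simpa only [sqrt_dotProduct_self] using (hcomp x).1
    · simpa only [sqrt_dotProduct_self] using (hcomp x).2
  have hw : LinearIndependent ℝ B.col :=
    linearIndependent_cols_of_det_ne_zero hB
  rw [range_mulVec_eq_intSpan]
  have hpos : ∀ l ≤ n, 0 < ∏ i ∈ Finset.Icc 1 l, succMin F (intSpan B.col) i := fun l hl =>
    Finset.prod_pos fun i hi => succMin_pos hw hκ₁ hF (Finset.mem_Icc.1 hi).1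
      ((Finset.mem_Icc.1 hi).2.trans hl)
  refine ⟨fun l _ hl => ⟨?_, ?_⟩, fun j μ hj hjn hμ hle hlt => ⟨?_, ?_⟩⟩
  · have h := le_alphaE hw hκ₁ hκ₂ hF hl
    rw [← prod_Icc_one_eq_prod_fin] at h
    refine le_trans (mul_le_mul_of_nonneg_right ?_ (inv_nonneg.2 (hpos l hl).le)) h
    calc _ ≤ min 1 (κ₁ / 2) ^ n := min_le_left _ _
      _ ≤ min 1 (κ₁ / 2) ^ l := pow_le_pow_of_le_one (by positivity) (min_le_left _ _) hl
      _ ≤ (κ₁ / 2) ^ l := by gcongr; exact min_le_right _ _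
  · have h := (isLUB_alphaE_and_le hw hκ₁ hκ₂ hF hl).2
    rw [← prod_Icc_one_eq_prod_fin] at h
    refine h.trans (mul_le_mul_of_nonneg_right ?_ (inv_nonneg.2 (hpos l hl).le))
    calc K ^ l ≤ max 1 K ^ l := by gcongr; exact le_max_right _ _
      _ ≤ max 1 K ^ n := pow_le_pow_right₀ (le_max_left _ _) hl
      _ ≤ _ := le_max_left _ _
  · have h := le_ncard hw hκ₁ hκ₂ hF hμ hj hjn
    rw [← prod_Icc_one_eq_prod_fin] at h
    refine le_trans (mul_le_mul_of_nonneg_right ?_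
      (mul_nonneg (by positivity) (inv_nonneg.2 (hpos j hjn).le))) h
    refine (min_le_right _ _).trans (pow_le_pow_of_le_one (by positivity) ?_ hjn)
    rw [div_le_one (by positivity)]
    linarith
  · refine (ncard_le hw hκ₁ hκ₂ hF hμ hjn hle hlt).trans (mul_le_mul_of_nonneg_right
      (le_max_right _ _) (mul_nonneg (by positivity) (inv_nonneg.2 (hpos j hjn).le)))
end
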